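/- Define the Airy function Ai : ℝ → ℝ by Ai(a) = (1/π) · lim_{R→∞} ∫₀^R cos(s³/3 + a s) ds. Fix λ ∈ (0,1), set χ = λ(1−λ), and fix real numbers ξ_j, u_j, β and T ≥ 0. For t > 0 define n_j(t) = ⌊λ² t + λ 2^{5/3} χ^{1/3} ξ_j t^{2/3}⌋, x_j(t) = ⌊(1−2λ) t − 2^{5/3} χ^{1/3} ξ_j t^{2/3} − 2^{1/3} χ^{2/3} (u_j/λ) t^{1/3}⌋, τ(t) = ⌊2^{5/3} χ^{1/3} λ T t^{2/3}⌋, b(t) = ⌊−2^{5/3} χ^{1/3} T t^{2/3} + 2^{1/3} χ^{2/3} (β/λ) t^{1/3}⌋, and m(t) = n_j(t) − τ(t). For any fixed radius r ∈ (0,1) set S̄(t) = (1−λ)^{b(t) − x_j(t) − m(t)} · λ^{m(t)} · (1/(2πi)) ∮_{|w|=r} (1−w)^{x_j(t) − b(t) + m(t) − 1} e^{t(w−λ)} w^{−m(t)} dw (for all sufficiently large t one has m(t) ≥ 1 and x_j(t) − b(t) + m(t) − 1 ≥ 0, so the integrand is meromorphic with its only pole at w = 0 and the integral is independent of r). Then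 lim_{t→∞} (2^{1/3} χ^{2/3} t^{1/3} / λ) · S̄(t) = 2^{1/3} · Ai( 2^{4/3} (ξ_j − T)² + 2^{1/3}(u_j + β) ) · e^{ (8/3)(ξ_j − T)³ + 2 (ξ_j − T)(u_j + β) }. -/

import Mathlib

open Filter intervalIntegral

/-- The Airy function, `Ai(a) = (1/π) lim_{R→∞} ∫₀^R cos(s³/3 + a s) ds`. -/
noncomputable def Ai (a : ℝ) : ℝ :=
  (1 / Real.pi) *
    limUnder atTop (fun R : ℝ => ∫ s in (0:ℝ)..R, Real.cos (s ^ 3 / 3 + a * s))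

/-- The KPZ-scaled particle index `n(t) = ⌊λ² t + λ 2^{5/3} χ^{1/3} ξ t^{2/3}⌋`,
with `χ = λ(1−λ)` (scaling (A.6) of the paper). -/
noncomputable def nIdx (lam ξ : ℝ) (t : ℝ) : ℤ :=
  ⌊lam ^ 2 * t + lam * 2 ^ ((5:ℝ)/3) * (lam * (1 - lam)) ^ ((1:ℝ)/3) * ξ * t ^ ((2:ℝ)/3)⌋

/-- The KPZ-scaled space point
`x(t) = ⌊(1−2λ) t − 2^{5/3} χ^{1/3} ξ t^{2/3} − 2^{1/3} χ^{2/3} (u/λ) t^{1/3}⌋`. -/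
noncomputable def xIdx (lam ξ u : ℝ) (t : ℝ) : ℤ :=
  ⌊(1 - 2 * lam) * t - 2 ^ ((5:ℝ)/3) * (lam * (1 - lam)) ^ ((1:ℝ)/3) * ξ * t ^ ((2:ℝ)/3)
    - 2 ^ ((1:ℝ)/3) * (lam * (1 - lam)) ^ ((2:ℝ)/3) * (u / lam) * t ^ ((1:ℝ)/3)⌋

/-- The random-walk time scaling `τ(t) = ⌊2^{5/3} χ^{1/3} λ T t^{2/3}⌋`
of (A.8) of the paper. -/
noncomputable def tauIdx (lam T : ℝ) (t : ℝ) : ℤ :=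
  ⌊2 ^ ((5:ℝ)/3) * (lam * (1 - lam)) ^ ((1:ℝ)/3) * lam * T * t ^ ((2:ℝ)/3)⌋

/-- The random-walk position scaling
`b(t) = ⌊−2^{5/3} χ^{1/3} T t^{2/3} + 2^{1/3} χ^{2/3} (β/λ) t^{1/3}⌋`
of (A.8) of the paper. -/
noncomputable def bIdx (lam T β : ℝ) (t : ℝ) : ℤ :=
  ⌊-(2 ^ ((5:ℝ)/3)) * (lam * (1 - lam)) ^ ((1:ℝ)/3) * T * t ^ ((2:ℝ)/3)
    + 2 ^ ((1:ℝ)/3) * (lam * (1 - lam)) ^ ((2:ℝ)/3) * (β / lam) * t ^ ((1:ℝ)/3)⌋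

/-- `m(t) = n_j(t) − τ(t)`. -/
noncomputable def mIdx (lam ξj T : ℝ) (t : ℝ) : ℤ :=
  nIdx lam ξj t - tauIdx lam T t

/-- The conjugated kernel entry `S̄_{−t, n_j−τ}(B_τ, x_j)` of (A.7) of the paper:
`S̄(t) = (1−λ)^{b−x_j−m} λ^{m} (2πi)⁻¹ ∮_{|w|=r} (1−w)^{x_j−b+m−1} e^{t(w−λ)} w^{−m} dw`,
under the KPZ scaling (A.6) and the random-walk scaling (A.8). -/
noncomputable def SbarKernel (lam ξj uj T β r : ℝ) (t : ℝ) : ℂ :=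
  ((1 : ℂ) - (lam : ℂ)) ^ (bIdx lam T β t - xIdx lam ξj uj t - mIdx lam ξj T t)
    * (lam : ℂ) ^ (mIdx lam ξj T t)
    * ((2 * (Real.pi : ℂ) * Complex.I)⁻¹
        * ∮ w in C(0, r),
            (1 - w) ^ (xIdx lam ξj uj t - bIdx lam T β t + mIdx lam ξj T t - 1)
              * Complex.exp ((t : ℂ) * (w - (lam : ℂ)))
              * w ^ (-(mIdx lam ξj T t)))

open scoped Topology

theorem norm_airy_integrand (A x y : ℝ) :
    ‖Complex.exp (-(x + y * Complex.I : ℂ) ^ 3 / 3 + A * (x + y * Complex.I))‖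
      = Real.exp (-x ^ 3 / 3 + x * y ^ 2 + A * x) := by
  have : (-(x + y * Complex.I : ℂ) ^ 3 / 3 + A * (x + y * Complex.I))
      = ((-x ^ 3 / 3 + x * y ^ 2 + A * x : ℝ) : ℂ)
        + ((-x ^ 2 * y + y ^ 3 / 3 + A * y : ℝ) : ℂ) * Complex.I := by
    push_cast
    linear_combination (-x * y ^ 2 - y ^ 3 * Complex.I / 3) * Complex.I_sq
  rw [this, Complex.norm_exp]
  simp only [Complex.add_re, Complex.ofReal_re, Complex.re_ofReal_mul, Complex.I_re, mul_zero,
    add_zero]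

theorem continuous_airy_integrand (A x : ℝ) : Continuous fun y : ℝ =>
    Complex.exp (-(x + y * Complex.I : ℂ) ^ 3 / 3 + A * (x + y * Complex.I)) := by
  fun_prop

theorem integrable_airy_integrand (A : ℝ) : MeasureTheory.Integrable fun y : ℝ =>
    Complex.exp (-((-1 : ℝ) + y * Complex.I : ℂ) ^ 3 / 3 + A * ((-1 : ℝ) + y * Complex.I)) := by
  refine MeasureTheory.Integrable.mono'
    ((integrable_exp_neg_mul_sq one_pos).const_mul (Real.exp (1 / 3 - A)))
    (continuous_airy_integrand A (-1)).aestronglyMeasurable (.of_forall fun y => ?_)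
  rw [norm_airy_integrand, ← Real.exp_add]
  apply le_of_eq
  congr 1
  ring

theorem tendsto_airy_integrand_horizontal (A ε : ℝ) (hε : ε ^ 2 = 1) :
    Tendsto (fun R : ℝ => ∫ x in (-1 : ℝ)..0,
      Complex.exp (-(x + (ε * R : ℝ) * Complex.I : ℂ) ^ 3 / 3
        + A * (x + (ε * R : ℝ) * Complex.I))) atTop (𝓝 0) := by
  have h := intervalIntegral.tendsto_integral_filter_of_dominated_convergence
    (μ := MeasureTheory.volume) (a := -1) (b := 0) (l := (atTop : Filter ℝ))
    (F := fun R x => Complex.exp (-(x + (ε * R : ℝ) * Complex.I : ℂ) ^ 3 / 3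
        + A * (x + (ε * R : ℝ) * Complex.I))) (f := fun _ => (0 : ℂ))
    (fun _ => Real.exp (1 / 3 + |A|)) ?_ ?_ (by simp) ?_
  · simpa using h
  · refine .of_forall fun R => Continuous.aestronglyMeasurable ?_
    fun_prop
  · refine .of_forall fun R => .of_forall fun x hx => ?_
    rw [Set.uIoc_of_le (by norm_num)] at hx
    rw [norm_airy_integrand]
    apply Real.exp_le_exp.mpr
    have h1 : A * x ≤ |A| := by
      calc A * x ≤ |A * x| := le_abs_self _
        _ = |A| * |x| := abs_mul _ _
        _ ≤ |A| * 1 := by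
          gcongr
          exact abs_le.mpr ⟨hx.1.le, hx.2.trans zero_le_one⟩
        _ = |A| := mul_one _
    have h2 : x * (ε * R) ^ 2 ≤ 0 := mul_nonpos_of_nonpos_of_nonneg hx.2 (sq_nonneg _)
    have h3 : -1 ≤ x ^ 3 := by nlinarith [hx.1, hx.2, sq_nonneg x, sq_nonneg (x - 1)]
    linarith
  · have hne : ∀ᵐ x : ℝ, x ≠ 0 := by
      simp [MeasureTheory.ae_iff]
    filter_upwards [hne] with x hx0 hx
    rw [Set.uIoc_of_le (by norm_num)] at hx
    have hxneg : x < 0 := lt_of_le_of_ne hx.2 hx0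
    rw [tendsto_zero_iff_norm_tendsto_zero]
    simp_rw [norm_airy_integrand, mul_pow, hε, one_mul]
    refine Real.tendsto_exp_atBot.comp ?_
    refine tendsto_atBot_add_const_right _ _ (tendsto_atBot_add_const_left _ _ ?_)
    exact (tendsto_pow_atTop two_ne_zero).const_mul_atTop_of_neg hxneg

theorem integral_exp_cubic_phase (A R : ℝ) :
    ∫ y in (-R)..R, Complex.exp (-((0 : ℝ) + y * Complex.I : ℂ) ^ 3 / 3
        + A * ((0 : ℝ) + y * Complex.I))
      = 2 * ((∫ s in (0 : ℝ)..R, Real.cos (s ^ 3 / 3 + A * s) : ℝ) : ℂ) := by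
  set g : ℝ → ℂ := fun y => Complex.exp (-((0 : ℝ) + y * Complex.I : ℂ) ^ 3 / 3
        + A * ((0 : ℝ) + y * Complex.I)) with hg
  have hcont : Continuous g := continuous_airy_integrand A 0
  have hgy : ∀ y : ℝ, g y = Complex.exp (((y ^ 3 / 3 + A * y : ℝ) : ℂ) * Complex.I) := by
    intro y
    simp only [hg]
    congr 1
    push_cast
    linear_combination (-y ^ 3 * Complex.I / 3) * Complex.I_sq
  have hsum : ∀ y : ℝ, g (-y) + g y = 2 * ((Real.cos (y ^ 3 / 3 + A * y) : ℝ) : ℂ) := by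
    intro y
    rw [hgy, hgy, Complex.ofReal_cos, Complex.two_cos, add_comm]
    congr 2
    push_cast
    ring
  rw [← intervalIntegral.integral_add_adjacent_intervals (b := 0)
    (hcont.intervalIntegrable _ _) (hcont.intervalIntegrable _ _)]
  have hrefl : ∫ y in (-R)..0, g y = ∫ y in (0 : ℝ)..R, g (-y) := by
    rw [intervalIntegral.integral_comp_neg, neg_zero]
  rw [hrefl, ← intervalIntegral.integral_add (f := fun y => g (-y))
    ((hcont.comp continuous_neg).intervalIntegrable _ _) (hcont.intervalIntegrable _ _)]
  simp_rw [hsum]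
  rw [intervalIntegral.integral_const_mul, intervalIntegral.integral_ofReal]

theorem tendsto_integral_cos_cubic (A : ℝ) :
    Tendsto (fun R : ℝ => ((∫ s in (0 : ℝ)..R, Real.cos (s ^ 3 / 3 + A * s) : ℝ) : ℂ)) atTop
      (𝓝 ((∫ y : ℝ, Complex.exp (-((-1 : ℝ) + y * Complex.I : ℂ) ^ 3 / 3
        + A * ((-1 : ℝ) + y * Complex.I))) / 2)) := by
  have hV := MeasureTheory.intervalIntegral_tendsto_integral (integrable_airy_integrand A)
    tendsto_neg_atTop_atBot tendsto_id
  have hT := tendsto_airy_integrand_horizontal A 1 (by norm_num)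
  have hB := tendsto_airy_integrand_horizontal A (-1) (by norm_num)
  have hI : Tendsto (fun _ : ℝ => (Complex.I : ℂ)) atTop (𝓝 Complex.I) := tendsto_const_nhds
  have key := (hV.add (hI.mul (hB.sub hT))).div_const 2
  simp only [sub_zero, mul_zero, add_zero] at key
  refine key.congr fun R => ?_
  have hrect := Complex.integral_boundary_rect_eq_zero_of_differentiableOn
    (fun z : ℂ => Complex.exp (-z ^ 3 / 3 + A * z)) (-1 - R * Complex.I) (R * Complex.I)
    (by fun_prop)
  have e := integral_exp_cubic_phase A R
  simp only [Complex.sub_re, Complex.neg_re, Complex.one_re, Complex.re_ofReal_mul, Complex.I_re,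
    Complex.sub_im, Complex.neg_im, Complex.one_im, Complex.im_ofReal_mul, Complex.I_im, mul_zero,
    sub_zero, mul_one, neg_zero, zero_sub, smul_eq_mul] at hrect
  simp only [id, neg_mul, one_mul]
  rw [← mul_right_inj' (two_ne_zero' ℂ), ← e]
  generalize (∫ y in (-R)..R, Complex.exp (-((0 : ℝ) + y * Complex.I : ℂ) ^ 3 / 3
        + A * ((0 : ℝ) + y * Complex.I))) = V₀ at hrect ⊢
  generalize (∫ y in (-R)..R, Complex.exp (-((-1 : ℝ) + y * Complex.I : ℂ) ^ 3 / 3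
        + A * ((-1 : ℝ) + y * Complex.I))) = V₁ at hrect ⊢
  linear_combination Complex.I * hrect + (V₁ - V₀) * Complex.I_sq

theorem ofReal_Ai (A : ℝ) : (Ai A : ℂ) = (2 * Real.pi : ℂ)⁻¹ *
    ∫ y : ℝ, Complex.exp (-((-1 : ℝ) + y * Complex.I : ℂ) ^ 3 / 3
      + A * ((-1 : ℝ) + y * Complex.I)) := by
  have h := tendsto_integral_cos_cubic A
  have hre := (Complex.continuous_re.tendsto _).comp h
  have hlim : Tendsto (fun R : ℝ => ∫ s in (0 : ℝ)..R, Real.cos (s ^ 3 / 3 + A * s)) atTop _ := hre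
  have huniq := tendsto_nhds_unique ((Complex.continuous_ofReal.tendsto _).comp hlim) h
  rw [Ai, hlim.limUnder_eq, Complex.ofReal_mul, huniq]
  push_cast
  ring

theorem tendsto_cube_mul_log_remainder {ν : ℝ → ℝ} {l : Filter ℝ} (hν : Tendsto ν l atTop)
    {x : ℝ → ℂ} {c : ℂ} (hx : Tendsto (fun t => (ν t : ℂ) * x t) l (𝓝 c)) :
    Tendsto (fun t => (ν t : ℂ) ^ 3 *
      (Complex.log (1 + x t) - (x t - x t ^ 2 / 2 + x t ^ 3 / 3))) l (𝓝 0) := by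
  have hinv : Tendsto (fun t => ((ν t)⁻¹ : ℂ)) l (𝓝 0) := by
    have := (tendsto_inv_atTop_zero.comp hν)
    have h2 := (Complex.continuous_ofReal.tendsto 0).comp this
    simpa [Function.comp_def] using h2
  have hν0 : ∀ᶠ t in l, 0 < ν t := hν.eventually_gt_atTop 0
  have hx0 : Tendsto x l (𝓝 0) := by
    have h := hinv.mul hx
    rw [zero_mul] at h
    refine h.congr' ?_
    filter_upwards [hν0] with t ht
    have : (ν t : ℂ) ≠ 0 := by exact_mod_cast ht.ne'
    field_simp
  have hsmall : ∀ᶠ t in l, ‖x t‖ < 1 / 2 := by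
    have := hx0.norm
    rw [norm_zero] at this
    exact this.eventually_lt_const (by norm_num)
  have hbound : Tendsto (fun t => ‖(ν t : ℂ) * x t‖ ^ 3 * ‖x t‖) l (𝓝 0) := by
    have := (hx.norm.pow 3).mul hx0.norm
    simpa using this
  refine squeeze_zero_norm' ?_ hbound
  filter_upwards [hsmall] with t ht
  have h := Complex.norm_log_sub_logTaylor_le 3 (z := x t) (by linarith)
  have hT : Complex.logTaylor (3 + 1) (x t) = x t - x t ^ 2 / 2 + x t ^ 3 / 3 := by
    simp [Complex.logTaylor_succ, Complex.logTaylor_zero]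
    norm_num
    ring
  rw [hT] at h
  rw [norm_mul, norm_pow, norm_mul, mul_pow, mul_assoc]
  refine mul_le_mul_of_nonneg_left (h.trans ?_) (by positivity)
  have h3 : (1 - ‖x t‖)⁻¹ ≤ 2 := by
    rw [inv_le_comm₀ (by linarith) (by norm_num)]
    linarith
  have : 0 ≤ ‖x t‖ ^ 4 := by positivity
  norm_num
  nlinarith

theorem tendsto_saddle_exponent {lam : ℝ} (h0 : 0 < lam) (h1 : lam < 1) {N m : ℝ → ℤ}
    {A₁ A₂ : ℝ}
    (hA₁ : Tendsto (fun ν : ℝ => (ν ^ 3 - N ν / (1 - lam) - m ν / lam) / ν) atTop (𝓝 A₁))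
    (hA₂ : Tendsto (fun ν : ℝ => (m ν / lam ^ 2 - N ν / (1 - lam) ^ 2) / ν ^ 2) atTop (𝓝 A₂))
    (hN : Tendsto (fun ν : ℝ => (N ν : ℝ) / ν ^ 3) atTop (𝓝 ((1 - lam) ^ 2)))
    (hm : Tendsto (fun ν : ℝ => (m ν : ℝ) / ν ^ 3) atTop (𝓝 (lam ^ 2)))
    {h : ℝ → ℂ} {ζ : ℂ} (hh : Tendsto (fun ν : ℝ => (ν : ℂ) * h ν) atTop (𝓝 ζ)) :
    Tendsto (fun ν : ℝ => N ν * Complex.log (1 + -h ν / (1 - lam)) + ν ^ 3 * h ν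
        - m ν * Complex.log (1 + h ν / lam)) atTop
      (𝓝 (A₁ * ζ + A₂ / 2 * ζ ^ 2 - ζ ^ 3 / (3 * (lam * (1 - lam))))) := by
  have hl : (lam : ℂ) ≠ 0 := by exact_mod_cast h0.ne'
  have hl1 : (1 - lam : ℂ) ≠ 0 := by
    have : (1 - lam : ℝ) ≠ 0 := by linarith
    exact_mod_cast this
  have r1 := tendsto_cube_mul_log_remainder (ν := id) tendsto_id (x := fun ν => -h ν / (1 - lam))
    (c := -ζ / (1 - lam)) (by
      refine (hh.neg.div_const (1 - lam : ℂ)).congr fun ν => ?_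
      simp only [id]; ring)
  have r2 := tendsto_cube_mul_log_remainder (ν := id) tendsto_id (x := fun ν => h ν / lam)
    (c := ζ / lam) (by
      refine (hh.div_const (lam : ℂ)).congr fun ν => ?_
      simp only [id]; ring)
  have c1 := (Complex.continuous_ofReal.tendsto _).comp hA₁
  have c2 := (Complex.continuous_ofReal.tendsto _).comp hA₂
  have cN := (Complex.continuous_ofReal.tendsto _).comp hN
  have cm := (Complex.continuous_ofReal.tendsto _).comp hm
  have key := ((((c1.mul hh).add ((c2.div_const 2).mul (hh.pow 2))).sub
    (((hh.pow 3).div_const 3).mul ((cN.div_const ((1 - lam : ℂ) ^ 3)).add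
      (cm.div_const ((lam : ℂ) ^ 3))))).add (cN.mul r1)).sub (cm.mul r2)
  convert key.congr' ?_ using 2
  · push_cast
    field_simp
    ring
  · filter_upwards [eventually_gt_atTop 0] with ν hν
    have hν' : (ν : ℂ) ≠ 0 := by exact_mod_cast hν.ne'
    simp only [Function.comp, id]
    push_cast
    field_simp
    ring

/-- The integrand of the kernel, normalized to equal `1` at the critical point `w = lam`. -/
noncomputable def saddleIntegrand (lam : ℝ) (N m : ℤ) (t : ℝ) (w : ℂ) : ℂ :=
  ((1 - w) / (1 - lam)) ^ N * Complex.exp (t * (w - lam)) * (w / lam) ^ (-m)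

theorem tendsto_saddleIntegrand {lam : ℝ} (h0 : 0 < lam) (h1 : lam < 1) {N m : ℝ → ℤ}
    {A₁ A₂ : ℝ}
    (hA₁ : Tendsto (fun ν : ℝ => (ν ^ 3 - N ν / (1 - lam) - m ν / lam) / ν) atTop (𝓝 A₁))
    (hA₂ : Tendsto (fun ν : ℝ => (m ν / lam ^ 2 - N ν / (1 - lam) ^ 2) / ν ^ 2) atTop (𝓝 A₂))
    (hN : Tendsto (fun ν : ℝ => (N ν : ℝ) / ν ^ 3) atTop (𝓝 ((1 - lam) ^ 2)))
    (hm : Tendsto (fun ν : ℝ => (m ν : ℝ) / ν ^ 3) atTop (𝓝 (lam ^ 2)))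
    {w : ℝ → ℂ} {ζ : ℂ} (hw : Tendsto (fun ν : ℝ => (ν : ℂ) * (w ν - lam)) atTop (𝓝 ζ)) :
    Tendsto (fun ν : ℝ => saddleIntegrand lam (N ν) (m ν) (ν ^ 3) (w ν)) atTop
      (𝓝 (Complex.exp (A₁ * ζ + A₂ / 2 * ζ ^ 2 - ζ ^ 3 / (3 * (lam * (1 - lam)))))) := by
  have hl : (lam : ℂ) ≠ 0 := by exact_mod_cast h0.ne'
  have hl1 : (1 - lam : ℂ) ≠ 0 := by
    have : (1 - lam : ℝ) ≠ 0 := by linarith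
    exact_mod_cast this
  have hwlam : Tendsto w atTop (𝓝 lam) := by
    have hinv : Tendsto (fun ν : ℝ => (ν : ℂ)⁻¹) atTop (𝓝 0) := by
      simpa [Function.comp_def] using
        (Complex.continuous_ofReal.tendsto 0).comp (tendsto_inv_atTop_zero (𝕜 := ℝ))
    have h := (hinv.mul hw).add_const (lam : ℂ)
    rw [zero_mul, zero_add] at h
    refine h.congr' ?_
    filter_upwards [eventually_gt_atTop 0] with ν hν
    have : (ν : ℂ) ≠ 0 := by exact_mod_cast hν.ne'
    field_simp
    ring
  have hne0 : ∀ᶠ ν in atTop, w ν ≠ 0 := hwlam.eventually_ne hl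
  have hne1 : ∀ᶠ ν in atTop, w ν ≠ 1 :=
    hwlam.eventually_ne (by exact_mod_cast h1.ne)
  refine ((Complex.continuous_exp.tendsto _).comp
    (tendsto_saddle_exponent h0 h1 hA₁ hA₂ hN hm hw)).congr' ?_
  filter_upwards [hne0, hne1] with ν hw0 hw1
  have e1 : (1 : ℂ) + -(w ν - lam) / (1 - lam) = (1 - w ν) / (1 - lam) := by
    field_simp
    ring
  have e2 : (1 : ℂ) + (w ν - lam) / lam = w ν / lam := by
    field_simp
    ring
  have n1 : (1 - w ν) / (1 - lam : ℂ) ≠ 0 := div_ne_zero (sub_ne_zero.mpr hw1.symm) hl1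
  have n2 : w ν / (lam : ℂ) ≠ 0 := div_ne_zero hw0 hl
  rw [Function.comp, e1, e2, sub_eq_add_neg, Complex.exp_add, Complex.exp_add, ← neg_mul,
    ← Int.cast_neg, Complex.exp_int_mul, Complex.exp_int_mul, Complex.exp_log n1,
    Complex.exp_log n2, saddleIntegrand]
  push_cast
  rfl

theorem norm_saddleIntegrand_circleMap_le {lam ρ : ℝ} (hρ1 : ρ < 1) {N : ℤ} (hN : 0 ≤ N)
    (m : ℤ) (t θ : ℝ) :
    ‖saddleIntegrand lam N m t (circleMap 0 ρ θ)‖ ≤ ‖saddleIntegrand lam N m t ρ‖ *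
      Real.exp (ρ * (1 - Real.cos θ) * (N / (1 - ρ) ^ 2 - t)) := by
  lift N to ℕ using hN
  have hre : (circleMap 0 ρ θ).re = ρ * Real.cos θ := by
    simp [circleMap, Complex.exp_ofReal_mul_I_re]
  have him : (circleMap 0 ρ θ).im = ρ * Real.sin θ := by
    simp [circleMap, Complex.exp_ofReal_mul_I_im]
  have hnorm : ‖circleMap 0 ρ θ‖ = ‖(ρ : ℂ)‖ := by simp [circleMap]
  have hsq : ‖1 - circleMap 0 ρ θ‖ ^ 2 = (1 - ρ) ^ 2 + 2 * (ρ * (1 - Real.cos θ)) := by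
    rw [← Complex.normSq_eq_norm_sq, Complex.normSq_apply]
    simp only [Complex.sub_re, Complex.sub_im, Complex.one_re, Complex.one_im, hre, him]
    linear_combination ρ ^ 2 * Real.sin_sq_add_cos_sq θ
  set d := ρ * (1 - Real.cos θ) with hd
  have hρ' : 0 < 1 - ρ := by linarith
  have hone : ‖1 - circleMap 0 ρ θ‖ ≤ (1 - ρ) * Real.exp (d / (1 - ρ) ^ 2) := by
    apply le_of_sq_le_sq _ (by positivity)
    rw [hsq, mul_pow, ← Real.exp_nat_mul]
    have := Real.add_one_le_exp (((2 : ℕ) : ℝ) * (d / (1 - ρ) ^ 2))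
    calc (1 - ρ) ^ 2 + 2 * d = (1 - ρ) ^ 2 * (((2 : ℕ) : ℝ) * (d / (1 - ρ) ^ 2) + 1) := by
          push_cast
          field_simp
          ring
      _ ≤ _ := by gcongr
  have hone' : ‖(1 - ρ : ℂ)‖ = 1 - ρ := by
    rw [← Complex.ofReal_one, ← Complex.ofReal_sub, Complex.norm_real, Real.norm_of_nonneg hρ'.le]
  have hexp : ‖Complex.exp (t * (circleMap 0 ρ θ - lam))‖
      = ‖Complex.exp (t * (ρ - lam))‖ * Real.exp (-(t * d)) := by
    rw [Complex.norm_exp, Complex.norm_exp, ← Real.exp_add]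
    simp only [Complex.re_ofReal_mul, Complex.sub_re, Complex.ofReal_re, hre]
    congr 1
    ring
  simp only [saddleIntegrand, norm_mul, norm_zpow, norm_pow, norm_div, hnorm, hexp,
    zpow_natCast, hone']
  have hfin : Real.exp (d * (((N : ℤ) : ℝ) / (1 - ρ) ^ 2 - t))
      = Real.exp (d / (1 - ρ) ^ 2) ^ N * Real.exp (-(t * d)) := by
    rw [← Real.exp_nat_mul, ← Real.exp_add]
    congr 1
    push_cast
    ring
  rw [hfin]
  calc _ ≤ ((1 - ρ) * Real.exp (d / (1 - ρ) ^ 2) / ‖(1 - lam : ℂ)‖) ^ N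
        * (‖Complex.exp (t * (ρ - lam))‖ * Real.exp (-(t * d)))
        * (‖(ρ : ℂ)‖ / ‖(lam : ℂ)‖) ^ (-m) := by gcongr
    _ = _ := by
      rw [mul_div_right_comm, mul_pow]
      ring

theorem differentiableAt_saddleIntegrand {lam : ℝ} (hlam : lam ≠ 0) {N : ℤ} (hN : 0 ≤ N) (m : ℤ)
    (t : ℝ) {w : ℂ} (hw : w ≠ 0) : DifferentiableAt ℂ (saddleIntegrand lam N m t) w := by
  have hl : (lam : ℂ) ≠ 0 := by exact_mod_cast hlam
  unfold saddleIntegrand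
  exact ((DifferentiableAt.zpow (by fun_prop) (Or.inr hN)).mul (by fun_prop)).mul
    (DifferentiableAt.zpow (by fun_prop) (Or.inl (div_ne_zero hw hl)))

theorem circleIntegral_saddleIntegrand_eq {lam r R : ℝ} (hlam : lam ≠ 0) (hr : 0 < r) (hR : 0 < R)
    {N : ℤ} (hN : 0 ≤ N) (m : ℤ) (t : ℝ) :
    ∮ w in C(0, r), saddleIntegrand lam N m t w = ∮ w in C(0, R), saddleIntegrand lam N m t w := by
  wlog h : r ≤ R generalizing r R
  · exact (this hR hr (le_of_not_ge h)).symm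
  refine (Complex.circleIntegral_eq_of_differentiable_on_annulus_off_countable hr h
    Set.countable_empty
    (fun w hw => (differentiableAt_saddleIntegrand hlam hN m t ?_).continuousAt.continuousWithinAt)
    fun w hw => differentiableAt_saddleIntegrand hlam hN m t ?_).symm
  · rintro rfl
    exact hw.2 (Metric.mem_ball_self hr)
  · rintro rfl
    exact hw.1.2 (Metric.mem_closedBall_self hr.le)

theorem tendsto_mul_circleMap_sub {lam : ℝ} (P s : ℝ) :
    Tendsto (fun ν : ℝ => (ν : ℂ) * (circleMap 0 (lam + P / ν) (s / ν) - lam)) atTop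
      (𝓝 (P + lam * s * Complex.I)) := by
  have hinv : Tendsto (fun ν : ℝ => ν⁻¹) atTop (𝓝[≠] 0) :=
    tendsto_inv_atTop_nhdsGT_zero.mono_right (nhdsWithin_mono _ fun x hx => ne_of_gt hx)
  have hder : HasDerivAt
      (fun x : ℝ => ((lam + P * x : ℝ) : ℂ) * Complex.exp ((s * x : ℝ) * Complex.I))
      (P + lam * s * Complex.I) 0 := by
    have h1 : HasDerivAt (fun x : ℝ => ((lam + P * x : ℝ) : ℂ)) (P : ℂ) 0 := by
      have : HasDerivAt (fun x : ℝ => lam + P * x) P 0 := by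
        simpa using ((hasDerivAt_id (0 : ℝ)).const_mul P).const_add lam
      exact this.ofReal_comp
    have h2 : HasDerivAt (fun x : ℝ => Complex.exp ((s * x : ℝ) * Complex.I))
        (s * Complex.I) 0 := by
      have : HasDerivAt (fun x : ℝ => s * x) s 0 := by
        simpa using (hasDerivAt_id (0 : ℝ)).const_mul s
      simpa using (this.ofReal_comp.mul_const Complex.I).cexp
    simpa [mul_assoc] using h1.fun_mul h2
  refine (hder.tendsto_slope_zero.comp hinv).congr fun ν => ?_
  simp [circleMap, div_eq_mul_inv]

theorem tendsto_decay_rate {lam : ℝ} (h0 : 0 < lam) (h1 : lam < 1) {N m : ℝ → ℤ}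
    {A₁ A₂ : ℝ} (P : ℝ)
    (hA₁ : Tendsto (fun ν : ℝ => (ν ^ 3 - N ν / (1 - lam) - m ν / lam) / ν) atTop (𝓝 A₁))
    (hA₂ : Tendsto (fun ν : ℝ => (m ν / lam ^ 2 - N ν / (1 - lam) ^ 2) / ν ^ 2) atTop (𝓝 A₂))
    (hN : Tendsto (fun ν : ℝ => (N ν : ℝ) / ν ^ 3) atTop (𝓝 ((1 - lam) ^ 2))) :
    Tendsto (fun ν : ℝ => (N ν / (1 - (lam + P / ν)) ^ 2 - ν ^ 3) / ν ^ 2) atTop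
      (𝓝 (2 * P / (1 - lam) - lam * A₂)) := by
  have hl1 : 1 - lam ≠ 0 := by linarith
  have hinv : Tendsto (fun ν : ℝ => ν⁻¹) atTop (𝓝 0) := tendsto_inv_atTop_zero
  have hρ : Tendsto (fun ν : ℝ => 1 - (lam + P * ν⁻¹)) atTop (𝓝 (1 - lam)) := by
    simpa using (hinv.const_mul P).const_add lam |>.const_sub 1
  have hq : Tendsto (fun ν : ℝ => P * (2 * (1 - lam) - P * ν⁻¹) /
      ((1 - (lam + P * ν⁻¹)) ^ 2 * (1 - lam) ^ 2)) atTop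
      (𝓝 (P * (2 * (1 - lam) - P * 0) / ((1 - lam) ^ 2 * (1 - lam) ^ 2))) :=
    (((hinv.const_mul P).const_sub _).const_mul P).div ((hρ.pow 2).mul_const _) (by positivity)
  have key := ((hN.mul hq).sub (hA₁.mul hinv)).sub (hA₂.const_mul lam)
  convert key.congr' ?_ using 2
  · field_simp
    ring
  · filter_upwards [eventually_gt_atTop 0, hρ.eventually_ne hl1] with ν hν hne
    rw [← div_eq_mul_inv] at *
    have hne' : ν * (1 - lam) - P ≠ 0 := by
      intro h
      apply hne
      field_simp
      linarith
    have e : 1 - (lam + P / ν) = (ν * (1 - lam) - P) / ν := by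
      field_simp
      ring
    simp only [e]
    field_simp
    ring

theorem mul_circleIntegral_eq_integral_indicator (f : ℂ → ℂ) (ρ : ℝ) {ν : ℝ} (hν : 0 < ν) :
    (ν : ℂ) * ((2 * (Real.pi : ℂ) * Complex.I)⁻¹ * ∮ w in C(0, ρ), f w)
      = (2 * (Real.pi : ℂ))⁻¹ * ∫ s : ℝ, (Set.Ioc (-(Real.pi * ν)) (Real.pi * ν)).indicator
        (fun s : ℝ => circleMap 0 ρ (s / ν) * f (circleMap 0 ρ (s / ν))) s := by
  have hper : Function.Periodic (fun θ : ℝ => circleMap 0 ρ θ * f (circleMap 0 ρ θ))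
      (2 * Real.pi) := by
    intro θ
    simp only [periodic_circleMap 0 ρ θ]
  have hshift := hper.intervalIntegral_add_eq 0 (-Real.pi)
  rw [zero_add, show -Real.pi + 2 * Real.pi = Real.pi by ring] at hshift
  have hcirc : ∮ w in C(0, ρ), f w
      = Complex.I * ∫ θ in (-Real.pi)..Real.pi, circleMap 0 ρ θ * f (circleMap 0 ρ θ) := by
    rw [circleIntegral, ← hshift, ← intervalIntegral.integral_const_mul]
    congr 1
    ext θ
    rw [deriv_circleMap, smul_eq_mul]
    ring
  have hpi : 0 < Real.pi := Real.pi_pos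
  rw [MeasureTheory.integral_indicator measurableSet_Ioc,
    ← intervalIntegral.integral_of_le (by nlinarith),
    intervalIntegral.integral_comp_div (fun θ => circleMap 0 ρ θ * f (circleMap 0 ρ θ)) hν.ne',
    hcirc, neg_div, mul_div_cancel_right₀ _ hν.ne', Complex.real_smul]
  have := Complex.I_ne_zero
  have : (Real.pi : ℂ) ≠ 0 := by exact_mod_cast hpi.ne'
  field_simp

theorem tendsto_mul_circleIntegral_saddleIntegrand {lam : ℝ} (h0 : 0 < lam) (h1 : lam < 1)
    {N m : ℝ → ℤ} {A₁ A₂ P r : ℝ} (hr : 0 < r) (hP : P < lam * (1 - lam) * A₂ / 2)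
    (hA₁ : Tendsto (fun ν : ℝ => (ν ^ 3 - N ν / (1 - lam) - m ν / lam) / ν) atTop (𝓝 A₁))
    (hA₂ : Tendsto (fun ν : ℝ => (m ν / lam ^ 2 - N ν / (1 - lam) ^ 2) / ν ^ 2) atTop (𝓝 A₂))
    (hN : Tendsto (fun ν : ℝ => (N ν : ℝ) / ν ^ 3) atTop (𝓝 ((1 - lam) ^ 2)))
    (hm : Tendsto (fun ν : ℝ => (m ν : ℝ) / ν ^ 3) atTop (𝓝 (lam ^ 2))) :
    Tendsto (fun ν : ℝ => (ν : ℂ) * ((2 * (Real.pi : ℂ) * Complex.I)⁻¹ *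
        ∮ w in C(0, r), saddleIntegrand lam (N ν) (m ν) (ν ^ 3) w)) atTop
      (𝓝 ((2 * (Real.pi : ℂ))⁻¹ * ∫ s : ℝ, lam * Complex.exp (A₁ * (P + lam * s * Complex.I)
        + A₂ / 2 * (P + lam * s * Complex.I) ^ 2
        - (P + lam * s * Complex.I) ^ 3 / (3 * (lam * (1 - lam)))))) := by
  have hl1 : 0 < 1 - lam := by linarith
  have hpi := Real.pi_pos
  have hρ : Tendsto (fun ν : ℝ => lam + P / ν) atTop (𝓝 lam) := by
    simpa using (tendsto_const_nhds (x := lam)).add (tendsto_const_nhds.div_atTop tendsto_id)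
  have hrate := tendsto_decay_rate h0 h1 P hA₁ hA₂ hN
  set κ := (lam * A₂ - 2 * P / (1 - lam)) / 2 with hκ
  have hκ0 : 0 < κ := by
    have : 2 * P / (1 - lam) < lam * A₂ := by
      rw [div_lt_iff₀ hl1]
      linarith
    linarith
  have hrate' := hrate.eventually_lt_const (u := -κ) (by linarith)
  have hpt := fun s : ℝ => tendsto_saddleIntegrand h0 h1 hA₁ hA₂ hN hm
    (tendsto_mul_circleMap_sub (lam := lam) P s)
  obtain ⟨K, hK⟩ : ∃ K : ℝ, ∀ᶠ ν : ℝ in atTop,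
      ‖saddleIntegrand lam (N ν) (m ν) (ν ^ 3) ((lam + P / ν : ℝ) : ℂ)‖ ≤ K := by
    have hle := (hpt 0).norm.eventually_le_const (lt_add_one _)
    simp only [circleMap, zero_div, Complex.ofReal_zero, zero_mul, Complex.exp_zero, mul_one,
      zero_add] at hle
    exact ⟨_, hle⟩
  have hNnonneg : ∀ᶠ ν : ℝ in atTop, 0 ≤ N ν := by
    filter_upwards [hN.eventually_const_lt (u := 0) (by positivity), eventually_gt_atTop 0]
      with ν hlt hν
    have : 0 < (N ν : ℝ) := by
      by_contra hcon
      exact absurd hlt (not_lt.mpr (div_nonpos_of_nonpos_of_nonneg (not_lt.mp hcon)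
        (by positivity)))
    exact_mod_cast this.le
  have hρlow := hρ.eventually_const_lt (u := lam / 2) (by linarith)
  have hρup := hρ.eventually_lt_const (u := 1) h1
  have hdct := MeasureTheory.tendsto_integral_filter_of_dominated_convergence
    (μ := MeasureTheory.volume) (l := (atTop : Filter ℝ))
    (F := fun (ν s : ℝ) => (Set.Ioc (-(Real.pi * ν)) (Real.pi * ν)).indicator
      (fun s : ℝ => circleMap 0 (lam + P / ν) (s / ν) *
        saddleIntegrand lam (N ν) (m ν) (ν ^ 3) (circleMap 0 (lam + P / ν) (s / ν))) s)
    (f := fun s : ℝ => lam * Complex.exp (A₁ * (P + lam * s * Complex.I)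
        + A₂ / 2 * (P + lam * s * Complex.I) ^ 2
        - (P + lam * s * Complex.I) ^ 3 / (3 * (lam * (1 - lam)))))
    (fun s => K * Real.exp (-(lam * κ / Real.pi ^ 2) * s ^ 2)) ?_ ?_ ?_ ?_
  · refine (hdct.const_mul _).congr' ?_
    filter_upwards [hNnonneg, hρlow, eventually_gt_atTop 0] with ν hN0 hlow hν
    rw [← mul_circleIntegral_eq_integral_indicator _ _ hν,
      circleIntegral_saddleIntegrand_eq (R := lam + P / ν) h0.ne' hr (by linarith) hN0]
  · filter_upwards [hNnonneg, hρlow] with ν hN0 hlow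
    refine Measurable.aestronglyMeasurable (Measurable.indicator ?_ measurableSet_Ioc)
    refine Continuous.measurable (Continuous.mul (by fun_prop) ?_)
    refine continuous_iff_continuousAt.mpr fun s => ?_
    have hne : circleMap 0 (lam + P / ν) (s / ν) ≠ 0 := circleMap_ne_center (by linarith)
    exact ContinuousAt.comp (f := fun s : ℝ => circleMap 0 (lam + P / ν) (s / ν))
      (differentiableAt_saddleIntegrand h0.ne' hN0 _ _ hne).continuousAt
      (by fun_prop : Continuous fun s : ℝ => circleMap 0 (lam + P / ν) (s / ν)).continuousAt
  · filter_upwards [hNnonneg, hρlow, hρup, hK, hrate', eventually_gt_atTop 0]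
      with ν hN0 hlow hup hKν hrν hν
    refine .of_forall fun s => ?_
    have hK0 : 0 ≤ K := (norm_nonneg _).trans hKν
    by_cases hs : s ∈ Set.Ioc (-(Real.pi * ν)) (Real.pi * ν)
    swap
    · rw [Set.indicator_of_notMem hs, norm_zero]
      positivity
    rw [Set.indicator_of_mem hs, norm_mul]
    have hρ0 : 0 < lam + P / ν := by linarith
    have hc : ‖circleMap 0 (lam + P / ν) (s / ν)‖ ≤ 1 := by
      rw [norm_circleMap_zero, abs_of_pos hρ0]
      exact hup.le
    have habs : |s / ν| ≤ Real.pi := by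
      rw [abs_div, abs_of_pos hν, div_le_iff₀ hν]
      exact abs_le.mpr ⟨hs.1.le, hs.2⟩
    have hcos := Real.cos_le_one_sub_mul_cos_sq habs
    have hF := norm_saddleIntegrand_circleMap_le (lam := lam) hup hN0 (m ν) (ν ^ 3) (s / ν)
    have hrν' : N ν / (1 - (lam + P / ν)) ^ 2 - ν ^ 3 ≤ -κ * ν ^ 2 :=
      ((div_lt_iff₀ (by positivity)).mp hrν).le
    have hd : lam / 2 * (2 / Real.pi ^ 2 * (s / ν) ^ 2)
        ≤ (lam + P / ν) * (1 - Real.cos (s / ν)) := by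
      apply mul_le_mul hlow.le (by linarith) (by positivity) hρ0.le
    have hexp : (lam + P / ν) * (1 - Real.cos (s / ν)) *
        (N ν / (1 - (lam + P / ν)) ^ 2 - ν ^ 3) ≤ -(lam * κ / Real.pi ^ 2) * s ^ 2 := by
      have hd0 : 0 ≤ (lam + P / ν) * (1 - Real.cos (s / ν)) := le_trans (by positivity) hd
      calc _ ≤ (lam + P / ν) * (1 - Real.cos (s / ν)) * (-κ * ν ^ 2) :=
            mul_le_mul_of_nonneg_left hrν' hd0
        _ ≤ lam / 2 * (2 / Real.pi ^ 2 * (s / ν) ^ 2) * (-κ * ν ^ 2) :=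
            mul_le_mul_of_nonpos_right hd (by nlinarith [sq_nonneg ν])
        _ = _ := by field_simp
    calc _ ≤ 1 * (K * Real.exp (-(lam * κ / Real.pi ^ 2) * s ^ 2)) := by
          refine mul_le_mul hc (hF.trans ?_) (norm_nonneg _) zero_le_one
          gcongr
      _ = _ := one_mul _
  · exact (integrable_exp_neg_mul_sq (by positivity)).const_mul K
  · refine .of_forall fun s => ?_
    have hcm : Tendsto (fun ν : ℝ => circleMap 0 (lam + P / ν) (s / ν)) atTop (𝓝 (lam : ℂ)) := by
      have hs : Tendsto (fun ν : ℝ => s / ν) atTop (𝓝 0) := tendsto_const_nhds.div_atTop tendsto_id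
      have hcont : Continuous fun p : ℝ × ℝ => circleMap 0 p.1 p.2 := by
        unfold circleMap
        fun_prop
      have := (hcont.tendsto (lam, 0)).comp (hρ.prodMk_nhds hs)
      simpa [Function.comp_def, circleMap] using this
    refine (hcm.mul (hpt s)).congr' ?_
    filter_upwards [eventually_gt_atTop (|s| / Real.pi)] with ν hν
    rw [div_lt_iff₀ hpi, mul_comm] at hν
    have := abs_lt.mp hν
    rw [Set.indicator_of_mem (show s ∈ Set.Ioc _ _ from ⟨this.1, this.2.le⟩)]

theorem SbarKernel_eq_saddleIntegrand {lam : ℝ} (h1 : lam ≠ 1) (ξ u T β r t : ℝ) :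
    SbarKernel lam ξ u T β r t = (1 - lam : ℂ)⁻¹ * ((2 * (Real.pi : ℂ) * Complex.I)⁻¹ *
      ∮ w in C(0, r), saddleIntegrand lam
        (xIdx lam ξ u t - bIdx lam T β t + mIdx lam ξ T t - 1) (mIdx lam ξ T t) t w) := by
  have hl1 : (1 - lam : ℂ) ≠ 0 := sub_ne_zero.mpr (by exact_mod_cast h1.symm)
  rw [SbarKernel]
  set m := mIdx lam ξ T t
  set N := xIdx lam ξ u t - bIdx lam T β t + m - 1 with hN
  have hexp : bIdx lam T β t - xIdx lam ξ u t - m = -1 + -N := by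
    rw [hN]
    ring
  have hF : ∀ w : ℂ, saddleIntegrand lam N m t w = ((1 - lam : ℂ) ^ (-N) * (lam : ℂ) ^ m) *
      ((1 - w) ^ N * Complex.exp (t * (w - lam)) * w ^ (-m)) := by
    intro w
    rw [saddleIntegrand, div_zpow, div_zpow, zpow_neg (lam : ℂ), zpow_neg (1 - lam : ℂ),
      div_inv_eq_mul]
    ring
  simp_rw [hF, circleIntegral.integral_const_mul]
  rw [hexp, zpow_add₀ hl1, zpow_neg_one]
  ring

theorem tendsto_floor_sub_div (f : ℝ → ℝ) :
    Tendsto (fun ν : ℝ => ((⌊f ν⌋ : ℝ) - f ν) / ν) atTop (𝓝 0) := by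
  refine squeeze_zero_norm' ?_ tendsto_inv_atTop_zero
  filter_upwards [eventually_gt_atTop 0] with ν hν
  rw [norm_div, Real.norm_of_nonneg hν.le, div_eq_mul_inv]
  have h : ‖(⌊f ν⌋ : ℝ) - f ν‖ ≤ 1 := by
    rw [Real.norm_eq_abs, abs_le]
    constructor <;> linarith [Int.floor_le (f ν), Int.lt_floor_add_one (f ν)]
  calc _ ≤ 1 * ν⁻¹ := by gcongr
    _ = _ := one_mul _

theorem rpow_nat_div_three {x : ℝ} (hx : 0 ≤ x) (k : ℕ) :
    x ^ ((k : ℝ) / 3) = (x ^ ((1 : ℝ) / 3)) ^ k := by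
  rw [← Real.rpow_mul_natCast hx]
  congr 1
  ring

theorem rpow_one_third_pow {x : ℝ} (hx : 0 ≤ x) : (x ^ ((1 : ℝ) / 3)) ^ 3 = x := by
  rw [← rpow_nat_div_three hx]
  norm_num

theorem pow_rpow_one_third {x : ℝ} (hx : 0 ≤ x) : (x ^ 3) ^ ((1 : ℝ) / 3) = x := by
  rw [← Real.rpow_natCast_mul hx]
  norm_num

theorem exists_index_errors (lam ξ u T β : ℝ) :
    ∃ d₁ d₂ : ℝ → ℝ, Tendsto d₁ atTop (𝓝 0) ∧ Tendsto d₂ atTop (𝓝 0) ∧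
      ∀ ν : ℝ, 0 < ν →
        (mIdx lam ξ T (ν ^ 3) : ℝ) = lam ^ 2 * ν ^ 3 + lam * 2 ^ ((5 : ℝ) / 3) *
          (lam * (1 - lam)) ^ ((1 : ℝ) / 3) * (ξ - T) * ν ^ 2 + d₁ ν * ν ∧
        (xIdx lam ξ u (ν ^ 3) - bIdx lam T β (ν ^ 3) + mIdx lam ξ T (ν ^ 3) - 1 : ℝ) =
          (1 - lam) ^ 2 * ν ^ 3 - (1 - lam) * 2 ^ ((5 : ℝ) / 3) *
            (lam * (1 - lam)) ^ ((1 : ℝ) / 3) * (ξ - T) * ν ^ 2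
          - 2 ^ ((1 : ℝ) / 3) * (lam * (1 - lam)) ^ ((2 : ℝ) / 3) * ((u + β) / lam) * ν
          + d₂ ν * ν := by
  have dn := tendsto_floor_sub_div fun ν => lam ^ 2 * ν ^ 3 + lam * 2 ^ ((5 : ℝ) / 3) *
    (lam * (1 - lam)) ^ ((1 : ℝ) / 3) * ξ * (ν ^ 3) ^ ((2 : ℝ) / 3)
  have dx := tendsto_floor_sub_div fun ν => (1 - 2 * lam) * ν ^ 3 - 2 ^ ((5 : ℝ) / 3) *
    (lam * (1 - lam)) ^ ((1 : ℝ) / 3) * ξ * (ν ^ 3) ^ ((2 : ℝ) / 3)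
    - 2 ^ ((1 : ℝ) / 3) * (lam * (1 - lam)) ^ ((2 : ℝ) / 3) * (u / lam) * (ν ^ 3) ^ ((1 : ℝ) / 3)
  have dt := tendsto_floor_sub_div fun ν => 2 ^ ((5 : ℝ) / 3) *
    (lam * (1 - lam)) ^ ((1 : ℝ) / 3) * lam * T * (ν ^ 3) ^ ((2 : ℝ) / 3)
  have db := tendsto_floor_sub_div fun ν => -(2 ^ ((5 : ℝ) / 3)) *
    (lam * (1 - lam)) ^ ((1 : ℝ) / 3) * T * (ν ^ 3) ^ ((2 : ℝ) / 3)
    + 2 ^ ((1 : ℝ) / 3) * (lam * (1 - lam)) ^ ((2 : ℝ) / 3) * (β / lam) * (ν ^ 3) ^ ((1 : ℝ) / 3)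
  have hm := dn.sub dt
  have hN := ((dx.sub db).add hm).sub (tendsto_inv_atTop_zero (𝕜 := ℝ))
  simp only [sub_zero, add_zero] at hm hN
  refine ⟨_, _, hm, hN, fun ν hν => ?_⟩
  have e1 : (ν ^ 3) ^ ((1 : ℝ) / 3) = ν := pow_rpow_one_third hν.le
  have e2 : (ν ^ 3) ^ ((2 : ℝ) / 3) = ν ^ 2 := by
    have := rpow_nat_div_three (pow_nonneg hν.le 3) 2
    rw [e1] at this
    exact_mod_cast this
  simp only [mIdx, nIdx, xIdx, tauIdx, bIdx, e1, e2, Int.cast_sub]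
  constructor
  · field_simp
    ring
  · field_simp
    ring

theorem integral_saddle_limit_eq_Ai {lam : ℝ} (h0 : 0 < lam) {c q : ℝ}
    (hq0 : 0 < q) (hq3 : q ^ 3 = lam * (1 - lam)) (hc3 : c ^ 3 = 2) (X U : ℝ) :
    (2 * (Real.pi : ℂ))⁻¹ * ∫ s : ℝ, (lam : ℂ) * Complex.exp (
        ((c * q ^ 2 * U / (lam * (1 - lam)) : ℝ) : ℂ) *
          (((q * (c ^ 2 * X - 1) : ℝ) : ℂ) + lam * s * Complex.I)
        + ((2 * c ^ 2 * q * X / (lam * (1 - lam)) : ℝ) : ℂ) / 2 *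
          (((q * (c ^ 2 * X - 1) : ℝ) : ℂ) + lam * s * Complex.I) ^ 2
        - (((q * (c ^ 2 * X - 1) : ℝ) : ℂ) + lam * s * Complex.I) ^ 3 / (3 * (lam * (1 - lam))))
      = q * Ai (2 * c * X ^ 2 + c * U) * Real.exp ((8 / 3) * X ^ 3 + 2 * X * U) := by
  have hqC : (q : ℂ) ≠ 0 := by exact_mod_cast hq0.ne'
  have hlC : (lam : ℂ) ≠ 0 := by exact_mod_cast h0.ne'
  have hq3C : (q : ℂ) ^ 3 = lam * (1 - lam) := by exact_mod_cast hq3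
  have hc3C : (c : ℂ) ^ 3 = 2 := by exact_mod_cast hc3
  set E : ℂ := Complex.exp (((8 / 3) * X ^ 3 + 2 * X * U : ℝ) : ℂ) with hE
  set B := 2 * c * X ^ 2 + c * U with hB
  set g : ℝ → ℂ := fun y => Complex.exp (-((-1 : ℝ) + y * Complex.I : ℂ) ^ 3 / 3
    + B * ((-1 : ℝ) + y * Complex.I)) with hg
  have hint : ∀ s : ℝ, (lam : ℂ) * Complex.exp (
      ((c * q ^ 2 * U / (lam * (1 - lam)) : ℝ) : ℂ) *
        (((q * (c ^ 2 * X - 1) : ℝ) : ℂ) + lam * s * Complex.I)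
      + ((2 * c ^ 2 * q * X / (lam * (1 - lam)) : ℝ) : ℂ) / 2 *
        (((q * (c ^ 2 * X - 1) : ℝ) : ℂ) + lam * s * Complex.I) ^ 2
      - (((q * (c ^ 2 * X - 1) : ℝ) : ℂ) + lam * s * Complex.I) ^ 3 / (3 * (lam * (1 - lam))))
      = (lam * E) * g (lam / q * s) := by
    intro s
    simp only [hg]
    set y : ℂ := (-1 : ℝ) + ((lam / q * s : ℝ) : ℂ) * Complex.I with hy
    have hζ : ((q * (c ^ 2 * X - 1) : ℝ) : ℂ) + lam * s * Complex.I = q * (c ^ 2 * X + y) := by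
      rw [hy]
      push_cast
      field_simp
      ring
    rw [hζ, hE, mul_assoc (lam : ℂ) (Complex.exp _), ← Complex.exp_add, hB]
    congr 2
    push_cast
    rw [← hq3C]
    calc _ = (c : ℂ) * U * (c ^ 2 * X + y) + c ^ 2 * X * (c ^ 2 * X + y) ^ 2
          - (c ^ 2 * X + y) ^ 3 / 3 := by field_simp
      _ = _ := by
        linear_combination (X * U + 2 / 3 * X ^ 3 * (c ^ 3 + 2) + c * X ^ 2 * y) * hc3C
  simp_rw [hint]
  rw [MeasureTheory.integral_const_mul, MeasureTheory.Measure.integral_comp_mul_left,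
    show (Ai B : ℂ) = (2 * Real.pi : ℂ)⁻¹ * ∫ y : ℝ, g y from ofReal_Ai B,
    Complex.ofReal_exp, inv_div, abs_of_pos (by positivity), Complex.real_smul, ← hE]
  generalize ∫ y : ℝ, g y = J
  push_cast
  field_simp

theorem tendsto_mul_SbarKernel_cube {lam : ℝ} (h0 : 0 < lam) (h1 : lam < 1) (ξ u T β : ℝ)
    {r c q : ℝ} (hr : 0 < r) (hc : c = 2 ^ ((1 : ℝ) / 3))
    (hq : q = (lam * (1 - lam)) ^ ((1 : ℝ) / 3)) :
    Tendsto (fun ν : ℝ => ((c * q ^ 2 * ν / lam : ℝ) : ℂ) * SbarKernel lam ξ u T β r (ν ^ 3)) atTop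
      (𝓝 ((c * Ai (2 * c * (ξ - T) ^ 2 + c * (u + β)) *
        Real.exp ((8 / 3) * (ξ - T) ^ 3 + 2 * (ξ - T) * (u + β)) : ℝ) : ℂ)) := by
  have hl1 : 0 < 1 - lam := by linarith
  have hχ : 0 < lam * (1 - lam) := by positivity
  have hc3 : c ^ 3 = 2 := by rw [hc, rpow_one_third_pow (by norm_num)]
  have hq3 : q ^ 3 = lam * (1 - lam) := by rw [hq, rpow_one_third_pow hχ.le]
  have hq0 : 0 < q := by rw [hq]; positivity
  have hc5 : (2 : ℝ) ^ ((5 : ℝ) / 3) = 2 * c ^ 2 := by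
    have := rpow_nat_div_three (zero_le_two (α := ℝ)) 5
    rw [← hc] at this
    push_cast at this
    rw [this]
    linear_combination c ^ 2 * hc3
  have hq2 : (lam * (1 - lam)) ^ ((2 : ℝ) / 3) = q ^ 2 := by
    have := rpow_nat_div_three hχ.le 2
    rw [← hq] at this
    exact_mod_cast this
  obtain ⟨d₁, d₂, hd₁, hd₂, hidx⟩ := exists_index_errors lam ξ u T β
  rw [hc5, hq2, ← hc, ← hq] at hidx
  set X := ξ - T
  set U := u + β
  have hinv : Tendsto (fun ν : ℝ => ν⁻¹) atTop (𝓝 0) := tendsto_inv_atTop_zero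
  have hA₁ : Tendsto (fun ν : ℝ => (ν ^ 3 - ((xIdx lam ξ u (ν ^ 3) - bIdx lam T β (ν ^ 3)
      + mIdx lam ξ T (ν ^ 3) - 1 : ℤ) : ℝ) / (1 - lam) - mIdx lam ξ T (ν ^ 3) / lam) / ν) atTop
      (𝓝 (c * q ^ 2 * U / (lam * (1 - lam)))) := by
    have key := ((hd₂.div_const (1 - lam)).const_sub (c * q ^ 2 * U / (lam * (1 - lam)))).sub
      (hd₁.div_const lam)
    simp only [zero_div, sub_zero] at key
    refine key.congr' ?_
    filter_upwards [eventually_gt_atTop 0] with ν hν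
    push_cast
    rw [(hidx ν hν).2, (hidx ν hν).1]
    field_simp
    ring
  have hA₂ : Tendsto (fun ν : ℝ => (mIdx lam ξ T (ν ^ 3) / lam ^ 2 - ((xIdx lam ξ u (ν ^ 3)
      - bIdx lam T β (ν ^ 3) + mIdx lam ξ T (ν ^ 3) - 1 : ℤ) : ℝ) / (1 - lam) ^ 2) / ν ^ 2) atTop
      (𝓝 (2 * c ^ 2 * q * X / (lam * (1 - lam)))) := by
    have key := ((((hd₁.div_const (lam ^ 2)).sub (hd₂.div_const ((1 - lam) ^ 2))).add_const
      (c * q ^ 2 * (U / lam) / (1 - lam) ^ 2)).mul hinv).const_add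
      (2 * c ^ 2 * q * X / (lam * (1 - lam)))
    simp only [mul_zero, add_zero] at key
    refine key.congr' ?_
    filter_upwards [eventually_gt_atTop 0] with ν hν
    push_cast
    rw [(hidx ν hν).2, (hidx ν hν).1]
    field_simp
    ring
  have hN : Tendsto (fun ν : ℝ => ((xIdx lam ξ u (ν ^ 3) - bIdx lam T β (ν ^ 3)
      + mIdx lam ξ T (ν ^ 3) - 1 : ℤ) : ℝ) / ν ^ 3) atTop (𝓝 ((1 - lam) ^ 2)) := by
    have key := (((hinv.const_mul (-((1 - lam) * (2 * c ^ 2) * q * X))).add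
      ((hd₂.add_const (-(c * q ^ 2 * (U / lam)))).mul (hinv.pow 2)))).const_add ((1 - lam) ^ 2)
    simp only [ne_eq, OfNat.ofNat_ne_zero, not_false_eq_true, zero_pow, mul_zero, add_zero] at key
    refine key.congr' ?_
    filter_upwards [eventually_gt_atTop 0] with ν hν
    push_cast
    rw [(hidx ν hν).2]
    field_simp
    ring
  have hm : Tendsto (fun ν : ℝ => (mIdx lam ξ T (ν ^ 3) : ℝ) / ν ^ 3) atTop (𝓝 (lam ^ 2)) := by
    have key := (((hinv.const_mul (lam * (2 * c ^ 2) * q * X)).add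
      (hd₁.mul (hinv.pow 2)))).const_add (lam ^ 2)
    simp only [ne_eq, OfNat.ofNat_ne_zero, not_false_eq_true, zero_pow, mul_zero, add_zero] at key
    refine key.congr' ?_
    filter_upwards [eventually_gt_atTop 0] with ν hν
    rw [(hidx ν hν).1]
    field_simp
    ring
  have hP : q * (c ^ 2 * X - 1) <
      lam * (1 - lam) * (2 * c ^ 2 * q * X / (lam * (1 - lam))) / 2 := by
    rw [mul_div_cancel₀ _ hχ.ne']
    linarith
  have hlim := (tendsto_mul_circleIntegral_saddleIntegrand h0 h1 hr hP hA₁ hA₂ hN hm).const_mul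
    ((c * q ^ 2 / lam * (1 - lam)⁻¹ : ℝ) : ℂ)
  convert hlim using 2
  · rw [SbarKernel_eq_saddleIntegrand h1.ne]
    push_cast
    ring
  · rw [integral_saddle_limit_eq_Ai h0 hq0 hq3 hc3]
    have hcoef : c * q ^ 2 / lam * (1 - lam)⁻¹ * q = c := by
      field_simp
      linear_combination c * hq3
    rw [mul_assoc (q : ℂ), ← mul_assoc, ← Complex.ofReal_mul _ q, hcoef]
    push_cast
    ring

/-- the unnamed lemma following (A.8) in the paper.
Steep descent limit of `S̄_{−t, n_j−τ}(B_τ, x_j)` around the critical point `λ`: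
`lim_{t→∞} (2^{1/3} χ^{2/3} t^{1/3}/λ) S̄(t)
  = 2^{1/3} Ai(2^{4/3}(ξ_j−T)² + 2^{1/3}(u_j+β)) e^{(8/3)(ξ_j−T)³ + 2(ξ_j−T)(u_j+β)}`. -/
theorem SbarKernel_limit
    (lam : ℝ) (hlam0 : 0 < lam) (hlam1 : lam < 1)
    (ξj uj β : ℝ) (T : ℝ) (hT : 0 ≤ T)
    (r : ℝ) (hr0 : 0 < r) (hr1 : r < 1) :
    Tendsto
      (fun t : ℝ =>
        ((2 ^ ((1:ℝ)/3) * (lam * (1 - lam)) ^ ((2:ℝ)/3) * t ^ ((1:ℝ)/3) / lam : ℝ) : ℂ)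
          * SbarKernel lam ξj uj T β r t)
      atTop
      (nhds (((2 ^ ((1:ℝ)/3)
          * Ai (2 ^ ((4:ℝ)/3) * (ξj - T) ^ 2 + 2 ^ ((1:ℝ)/3) * (uj + β))
          * Real.exp ((8/3) * (ξj - T) ^ 3 + 2 * (ξj - T) * (uj + β)) : ℝ) : ℂ))) := by
  have hr3 : Tendsto (fun t : ℝ => t ^ ((1 : ℝ) / 3)) atTop atTop :=
    tendsto_rpow_atTop (by norm_num)
  have h4 : (2 : ℝ) ^ ((4 : ℝ) / 3) = 2 * 2 ^ ((1 : ℝ) / 3) := by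
    rw [show (4 : ℝ) / 3 = 1 + 1 / 3 by norm_num, Real.rpow_add two_pos, Real.rpow_one]
  have h2 := rpow_nat_div_three (mul_pos hlam0 (sub_pos.mpr hlam1)).le 2
  push_cast at h2
  rw [h4, h2]
  refine ((tendsto_mul_SbarKernel_cube hlam0 hlam1 ξj uj T β hr0 rfl rfl).comp hr3).congr' ?_
  filter_upwards [eventually_ge_atTop 0] with t ht
  simp only [Function.comp, rpow_one_third_pow ht]
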